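/- arXiv:2205.13055 — 2 statements merged into one kernel-verified Lean document; each statement's English description precedes it below -/
import Mathlib

section
/- Let 0 < μ ≤ L̄, 𝒜 > 0, A > 0, and let J be a nonnegative integer. Define log₁⁺(t) := max{ log t, 1 } for t > 0. If J ≥ 2√(2L̄/μ) · log₁⁺(L̄𝒜) and A ≥ (1/L̄)(1 + √(μ/(2L̄)))^J, then A ≥ 𝒜. -/
theorem Real.half_le_log_one_add {q : ℝ} (hq0 : 0 ≤ q) (hq1 : q ≤ 1) :
    q / 2 ≤ Real.log (1 + q) := by
  have hpos : 0 < 1 + q := by linarith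
  calc q / 2 ≤ q / (1 + q) := by gcongr; linarith
    _ = 1 - (1 + q)⁻¹ := by field_simp; ring
    _ ≤ Real.log (1 + q) := Real.one_sub_inv_le_log_of_pos hpos

/- STATEMENT 11: core estimate in the proof of Proposition 3.5(a).  With
`log₁⁺ t = max (log t) 1`: if `J ≥ 2√(2 Lbar/μ) · log₁⁺(Lbar 𝒜)` and
`A ≥ (1/Lbar)(1 + √(μ/(2 Lbar)))^J`, then `A ≥ 𝒜`. -/
theorem stmt_11
    (μ Lbar 𝒜 A : ℝ) (J : ℕ)
    (hμ : 0 < μ) (hμLbar : μ ≤ Lbar) (h𝒜 : 0 < 𝒜) (hA : 0 < A)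
    (hJ : (J : ℝ) ≥ 2 * Real.sqrt (2 * Lbar / μ) * max (Real.log (Lbar * 𝒜)) 1)
    (hAJ : A ≥ (1 / Lbar) * (1 + Real.sqrt (μ / (2 * Lbar))) ^ J) :
    A ≥ 𝒜 := by
  have hL : 0 < Lbar := hμ.trans_le hμLbar
  have hinv : Real.sqrt (2 * Lbar / μ) = (Real.sqrt (μ / (2 * Lbar)))⁻¹ := by
    rw [← Real.sqrt_inv, inv_div]
  rw [hinv] at hJ
  have hq0 : 0 < Real.sqrt (μ / (2 * Lbar)) := Real.sqrt_pos.mpr (by positivity)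
  have hq1 : Real.sqrt (μ / (2 * Lbar)) ≤ 1 :=
    Real.sqrt_le_one.mpr ((div_le_one (by positivity)).mpr (by linarith))
  set q := Real.sqrt (μ / (2 * Lbar))
  have hlog : Real.log (Lbar * 𝒜) ≤ Real.log ((1 + q) ^ J) := by
    rw [Real.log_pow]
    calc Real.log (Lbar * 𝒜) ≤ max (Real.log (Lbar * 𝒜)) 1 := le_max_left _ _
      _ = 2 * q⁻¹ * max (Real.log (Lbar * 𝒜)) 1 * (q / 2) := by field_simp
      _ ≤ J * Real.log (1 + q) := by
        gcongr
        exact Real.half_le_log_one_add hq0.le hq1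
  have hpow : Lbar * 𝒜 ≤ (1 + q) ^ J :=
    (Real.log_le_log_iff (by positivity) (by positivity)).mp hlog
  calc 𝒜 = (1 / Lbar) * (Lbar * 𝒜) := by field_simp
    _ ≤ (1 / Lbar) * (1 + q) ^ J := by gcongr
    _ ≤ A := hAJ
end

section
/- Fix an index j and suppose: (H0) μ > 0, A_{j+1} > 0, ξ_j := 1 + μA_j, ξ_{j+1} := 1 + μA_{j+1}, with 4 ≤ ξ_j ≤ ξ_{j+1}; (H1) (μA_{j+1}/2)‖y_{j+1} − x̃_j‖² + (ξ_{j+1}/2)‖y_j − x_{j+1}‖² ≤ A_{j+1}[ q^L_{j+1}(y_j) − ψ(y_{j+1}) ] + (ξ_j/2)‖y_j − x_j‖²; (H2) q^L_{j+1}(y_j) ≤ ψ(y_j); (H3) A_{j+1}[ ψ(y_j) − ψ(y_{j+1}) ] + (ξ_{j+1}/2)‖y_j − x_j‖² ≤ (1/2)‖y_j − y₀‖²; and (H4) ξ_{j+1}‖x_{j+1} − y_{j+1}‖² ≤ ‖y_{j+1} − y₀‖². Then ‖y_{j+1} − x̃_j‖² ≤ 13 ‖y_{j+1} − y₀‖²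 / (μ A_{j+1}). -/
/- STATEMENT 17: Lemma B.1(c).  Under hypotheses (H0)-(H4) (with `q` denoting the
real value `q^L_{j+1}(y j)` and `ψyj, ψyj1` the objective values at the two
iterates), one has `‖y (j+1) - x̃ j‖² ≤ 13 ‖y (j+1) - y₀‖² / (μ A (j+1))`. -/
theorem stmt_17
    {E : Type*} [NormedAddCommGroup E] [InnerProductSpace ℝ E] [FiniteDimensional ℝ E]
    (μ Aj Aj1 ξj ξj1 : ℝ)
    (hμ : 0 < μ) (hAj1 : 0 < Aj1)
    (hξj : ξj = 1 + μ * Aj) (hξj1 : ξj1 = 1 + μ * Aj1)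
    (hξj4 : 4 ≤ ξj) (hξjle : ξj ≤ ξj1)
    (y₀ yj yj1 xj xj1 xt : E) (q ψyj ψyj1 : ℝ)
    -- (H1)
    (hH1 : μ * Aj1 / 2 * ‖yj1 - xt‖ ^ 2 + ξj1 / 2 * ‖yj - xj1‖ ^ 2 ≤
      Aj1 * (q - ψyj1) + ξj / 2 * ‖yj - xj‖ ^ 2)
    -- (H2)
    (hH2 : q ≤ ψyj)
    -- (H3)
    (hH3 : Aj1 * (ψyj - ψyj1) + ξj1 / 2 * ‖yj - xj‖ ^ 2 ≤ 1 / 2 * ‖yj - y₀‖ ^ 2)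
    -- (H4)
    (hH4 : ξj1 * ‖xj1 - yj1‖ ^ 2 ≤ ‖yj1 - y₀‖ ^ 2) :
    ‖yj1 - xt‖ ^ 2 ≤ 13 * ‖yj1 - y₀‖ ^ 2 / (μ * Aj1) := by
  have hξ4 : 4 ≤ ξj1 := hξj4.trans hξjle
  have htri : ‖yj - y₀‖ ≤ ‖yj - xj1‖ + ‖xj1 - yj1‖ + ‖yj1 - y₀‖ := by
    have h := norm_add₃_le (a := yj - xj1) (b := xj1 - yj1) (c := yj1 - y₀)
    simpa only [sub_add_sub_cancel] using h
  have hmodel : Aj1 * (q - ψyj1) ≤ Aj1 * (ψyj - ψyj1) :=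
    mul_le_mul_of_nonneg_left (by linarith) hAj1.le
  have hξsq : ξj / 2 * ‖yj - xj‖ ^ 2 ≤ ξj1 / 2 * ‖yj - xj‖ ^ 2 := by gcongr
  have hmain : μ * Aj1 * ‖yj1 - xt‖ ^ 2 + ξj1 * ‖yj - xj1‖ ^ 2 ≤ ‖yj - y₀‖ ^ 2 := by
    linarith
  have hfour : 4 * ‖yj - xj1‖ ^ 2 ≤ ξj1 * ‖yj - xj1‖ ^ 2 := by gcongr
  have hfour' : 4 * ‖xj1 - yj1‖ ^ 2 ≤ ξj1 * ‖xj1 - yj1‖ ^ 2 := by gcongr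
  have hhalf : 2 * ‖xj1 - yj1‖ ≤ ‖yj1 - y₀‖ :=
    by
    refine (pow_le_pow_iff_left₀ (by positivity) (norm_nonneg _) two_ne_zero).1 ?_
    linarith
  have hsq : ‖yj - y₀‖ ^ 2 ≤ (‖yj - xj1‖ + 3 / 2 * ‖yj1 - y₀‖) ^ 2 :=
    pow_le_pow_left₀ (norm_nonneg _) (by linarith) 2
  rw [le_div_iff₀ (mul_pos hμ hAj1)]
  linarith [sq_nonneg (‖yj1 - y₀‖ - 2 * ‖yj - xj1‖), sq_nonneg ‖yj1 - y₀‖]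
end
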